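/- arXiv:1909.11530 — 2 statements merged into one kernel-verified Lean document; each statement's English description precedes it below -/
import Mathlib

section
/- Let (X,d) be a complete and connected metric space with 0 < ℋ¹(X) < ∞, equipped with the measure ℋ¹, and suppose there is a constant C₀ > 0 such that liminf_{r→0} ℋ¹(B(x,r))/r < C₀ for every x ∈ X. Then for every set E ⊂ X, ‖Dχ_E‖(X) ≤ C₀·Var(χ_E,X), where χ_E is the characteristic function of E. -/
open MeasureTheory Set Filter Topology ENNReal

/-- A rectifiable curve parametrized by arc length: a map defined (in effect) on `[0, len]`
whose variation on every subinterval `[s,t] ⊆ [0,len]` equals `t - s`. -/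
structure MCurve (X : Type*) [MetricSpace X] where
  len : ℝ
  len_nonneg : 0 ≤ len
  toFun : ℝ → X
  arclength : ∀ s t : ℝ, s ∈ Set.Icc 0 len → t ∈ Set.Icc 0 len → s ≤ t →
    eVariationOn toFun (Set.Icc s t) = ENNReal.ofReal (t - s)

namespace MCurve

variable {X : Type*} [MetricSpace X]

/-- The image of a curve. -/
def image (γ : MCurve X) : Set X := γ.toFun '' Set.Icc 0 γ.len

/-- A curve is simple (injective) if its parametrization is injective on `[0, len]`. -/
def IsSimple (γ : MCurve X) : Prop := Set.InjOn γ.toFun (Set.Icc 0 γ.len)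

end MCurve

/-- Pointwise variation `pV(v, X)`: supremum over finite collections of pairwise disjoint
injective arc-length parametrized curves of the sums of endpoint differences. -/
noncomputable def pVar {X : Type*} [MetricSpace X] (v : X → ℝ) : ℝ≥0∞ :=
  ⨆ (n : ℕ) (γ : Fin n → MCurve X) (_ : ∀ i, (γ i).IsSimple)
    (_ : ∀ i j, i ≠ j → Disjoint (γ i).image (γ j).image),
    ∑ i, ENNReal.ofReal |v ((γ i).toFun (γ i).len) - v ((γ i).toFun 0)|

/-- Pointwise variation `pV_D(v, X)` with curve endpoints restricted to lie in `D`. -/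
noncomputable def pVarOn {X : Type*} [MetricSpace X] (D : Set X) (v : X → ℝ) : ℝ≥0∞ :=
  ⨆ (n : ℕ) (γ : Fin n → MCurve X) (_ : ∀ i, (γ i).IsSimple)
    (_ : ∀ i j, i ≠ j → Disjoint (γ i).image (γ j).image)
    (_ : ∀ i, (γ i).toFun 0 ∈ D ∧ (γ i).toFun (γ i).len ∈ D),
    ∑ i, ENNReal.ofReal |v ((γ i).toFun (γ i).len) - v ((γ i).toFun 0)|

/-- `Var(u, X)`: infimum of `pV(v, X)` over representatives `v = u` a.e. -/
noncomputable def VarH {X : Type*} [MetricSpace X] [MeasurableSpace X]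
    (μ : Measure X) (u : X → ℝ) : ℝ≥0∞ :=
  ⨅ (v : X → ℝ) (_ : v =ᵐ[μ] u), pVar v

/-- `g` is an upper gradient of `u`: `g` is Borel and the upper gradient inequality holds
along every arc-length parametrized rectifiable curve. -/
def IsUpperGradient {X : Type*} [MetricSpace X] [MeasurableSpace X]
    (u : X → ℝ) (g : X → ℝ≥0∞) : Prop :=
  Measurable g ∧ ∀ γ : MCurve X,
    ENNReal.ofReal |u (γ.toFun γ.len) - u (γ.toFun 0)| ≤ ∫⁻ s in Set.Icc 0 γ.len, g (γ.toFun s)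

/-- The total variation `‖Du‖(X)`: infimum of `liminf ∫ gᵢ dμ` over sequences `uᵢ → u` in
`L¹(X, μ)` with upper gradients `gᵢ`. -/
noncomputable def totalVarH {X : Type*} [MetricSpace X] [MeasurableSpace X]
    (μ : Measure X) (u : X → ℝ) : ℝ≥0∞ :=
  ⨅ (ui : ℕ → X → ℝ) (gi : ℕ → X → ℝ≥0∞) (_ : ∀ i, IsUpperGradient (ui i) (gi i))
    (_ : Filter.Tendsto (fun i => ∫⁻ x, ENNReal.ofReal |ui i x - u x| ∂μ)
      Filter.atTop (nhds 0)),
    Filter.atTop.liminf (fun i => ∫⁻ x, gi i x ∂μ)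

namespace MCurve

variable {X : Type*} [MetricSpace X]

theorem dist_le (γ : MCurve X) {s t : ℝ} (hs : s ∈ Icc 0 γ.len) (ht : t ∈ Icc 0 γ.len) :
    dist (γ.toFun s) (γ.toFun t) ≤ |s - t| := by
  wlog h : s ≤ t generalizing s t
  · rw [dist_comm, abs_sub_comm]
    exact this ht hs (le_of_not_ge h)
  have h2 := eVariationOn.edist_le γ.toFun (left_mem_Icc.2 h) (right_mem_Icc.2 h)
  rw [γ.arclength s t hs ht h, edist_dist] at h2
  rw [abs_sub_comm, abs_of_nonneg (sub_nonneg.2 h)]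
  exact (ENNReal.ofReal_le_ofReal_iff (sub_nonneg.2 h)).1 h2

theorem lip (γ : MCurve X) : LipschitzOnWith 1 γ.toFun (Icc 0 γ.len) := by
  refine LipschitzOnWith.of_dist_le_mul fun s hs t ht => ?_
  simpa [Real.dist_eq] using γ.dist_le hs ht

/-- subcurve -/
def sub (γ : MCurve X) (a b : ℝ) (ha : 0 ≤ a) (hab : a ≤ b) (hb : b ≤ γ.len) : MCurve X where
  len := b - a
  len_nonneg := sub_nonneg.2 hab
  toFun := fun s => γ.toFun (s + a)
  arclength := by
    intro s t hs ht hst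
    have h : eVariationOn (γ.toFun ∘ fun s => s + a) (Icc s t) = _ :=
      eVariationOn.comp_eq_of_monotoneOn γ.toFun (fun s => s + a)
        (fun x _ y _ h => by simpa using h)
    have h2 := γ.arclength (s + a) (t + a) ⟨by linarith [hs.1], by linarith [hs.2]⟩
      ⟨by linarith [ht.1], by linarith [ht.2]⟩ (by linarith)
    rw [image_add_const_Icc, h2] at h
    rw [show t - s = t + a - (s + a) by ring, ← h]
    rfl

end MCurve

/-- Lipschitz connection inside a set -/
def LC {X : Type*} [MetricSpace X] (A : Set X) (x y : X) : Prop :=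
  ∃ (L : ℝ) (f : ℝ → X), 0 ≤ L ∧ f 0 = x ∧ f 1 = y ∧ (∀ s ∈ Icc (0:ℝ) 1, f s ∈ A) ∧
    ∀ s ∈ Icc (0:ℝ) 1, ∀ t ∈ Icc (0:ℝ) 1, s ≤ t → dist (f s) (f t) ≤ L * (t - s)

theorem LC.of_curve {X : Type*} [MetricSpace X] {A : Set X} (γ : MCurve X) (h : γ.image ⊆ A) :
    LC A (γ.toFun 0) (γ.toFun γ.len) := by
  have hm : ∀ s ∈ Icc (0:ℝ) 1, γ.len * s ∈ Icc 0 γ.len := fun s hs =>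
    ⟨mul_nonneg γ.len_nonneg hs.1, mul_le_of_le_one_right γ.len_nonneg hs.2⟩
  refine ⟨γ.len, fun s => γ.toFun (γ.len * s), γ.len_nonneg, by simp, by simp,
    fun s hs => h ⟨_, hm s hs, rfl⟩, fun s hs t ht hst => ?_⟩
  refine (γ.dist_le (hm s hs) (hm t ht)).trans ?_
  rw [← mul_sub, abs_mul, abs_of_nonneg γ.len_nonneg, abs_sub_comm, abs_of_nonneg (sub_nonneg.2 hst)]

theorem LC.refl {X : Type*} [MetricSpace X] {A : Set X} {x : X} (h : x ∈ A) : LC A x x :=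
  ⟨0, fun _ => x, le_rfl, rfl, rfl, fun _ _ => h, by simp⟩

theorem LC.symm {X : Type*} [MetricSpace X] {A : Set X} {x y : X} (h : LC A x y) : LC A y x := by
  obtain ⟨L, f, hL, h0, h1, hA, hf⟩ := h
  refine ⟨L, fun s => f (1 - s), hL, by simpa, by simpa, fun s hs => hA _ ⟨by linarith [hs.2],
    by linarith [hs.1]⟩, fun s hs t ht hst => ?_⟩
  rw [dist_comm]
  refine (hf _ ⟨by linarith [ht.2], by linarith [ht.1]⟩ _ ⟨by linarith [hs.2], by linarith [hs.1]⟩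
    (by linarith)).trans (le_of_eq (by ring))

theorem LC.trans {X : Type*} [MetricSpace X] {A : Set X} {x y z : X} (h : LC A x y)
    (h' : LC A y z) : LC A x z := by
  obtain ⟨L, f, hL, h0, h1, hA, hf⟩ := h
  obtain ⟨M, g, hM, g0, g1, gA, hg⟩ := h'
  refine ⟨2 * (L + M), fun s => if s ≤ 1/2 then f (2 * s) else g (2 * s - 1), by linarith, by simpa,
    by norm_num; exact g1, fun s hs => ?_, fun s hs t ht hst => ?_⟩
  · dsimp only
    split_ifs with h
    · exact hA _ ⟨by linarith [hs.1], by linarith⟩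
    · exact gA _ ⟨by linarith [hs.1], by linarith [hs.2]⟩
  · have hn : 0 ≤ t - s := by linarith
    have p1 := mul_nonneg hL hn
    have p2 := mul_nonneg hM hn
    dsimp only
    split_ifs with h1' h2' h2'
    · refine (hf _ ⟨by linarith [hs.1], by linarith⟩ _ ⟨by linarith [ht.1], by linarith⟩
        (by linarith)).trans ?_
      nlinarith
    · refine (dist_triangle _ (f 1) _).trans ?_
      have e1 := hf (2 * s) ⟨by linarith [hs.1], by linarith⟩ 1 (by simp) (by linarith)
      have e2 := hg 0 (by simp) (2 * t - 1) ⟨by linarith, by linarith [ht.2]⟩ (by linarith)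
      rw [g0, ← h1] at e2
      have q1 : L * (1 - 2 * s) ≤ L * (2 * (t - s)) := mul_le_mul_of_nonneg_left (by linarith) hL
      have q2 : M * (2 * t - 1 - 0) ≤ M * (2 * (t - s)) := mul_le_mul_of_nonneg_left (by linarith) hM
      linarith
    · exact absurd (hst.trans h2') h1'
    · refine (hg _ ⟨by linarith [hs.1], by linarith [hs.2]⟩ _ ⟨by linarith [ht.1], by linarith [ht.2]⟩
        (by linarith)).trans ?_
      nlinarith

/-- a Lipschitz injective path gives a simple curve -/
theorem exists_curve_of_inj {X : Type*} [MetricSpace X] {A : Set X} (L : ℝ) (f : ℝ → X)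
    (hL : 0 ≤ L) (hA : ∀ s ∈ Icc (0:ℝ) 1, f s ∈ A)
    (hf : ∀ s ∈ Icc (0:ℝ) 1, ∀ t ∈ Icc (0:ℝ) 1, s ≤ t → dist (f s) (f t) ≤ L * (t - s))
    (hinj : InjOn f (Icc 0 1)) :
    ∃ γ : MCurve X, γ.IsSimple ∧ γ.toFun 0 = f 0 ∧ γ.toFun γ.len = f 1 ∧ γ.image ⊆ A := by
  have hlip : LipschitzOnWith L.toNNReal f (Icc 0 1) := by
    refine LipschitzOnWith.of_dist_le_mul fun s hs t ht => ?_
    rw [Real.coe_toNNReal _ hL, Real.dist_eq]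
    rcases le_total s t with h | h
    · rw [abs_sub_comm, abs_of_nonneg (sub_nonneg.2 h)]; exact hf s hs t ht h
    · rw [dist_comm, abs_of_nonneg (sub_nonneg.2 h)]; exact hf t ht s hs h
  have hbv : LocallyBoundedVariationOn f (Icc 0 1) := hlip.locallyBoundedVariationOn
  have m0 : (0:ℝ) ∈ Icc (0:ℝ) 1 := by simp
  have m1 : (1:ℝ) ∈ Icc (0:ℝ) 1 := by simp
  set φ := variationOnFromTo f (Icc 0 1) 0 with hφ
  have hφ0 : φ 0 = 0 := variationOnFromTo.self _ _ _
  have hmono : MonotoneOn φ (Icc 0 1) := variationOnFromTo.monotoneOn hbv m0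
  have hstep : ∀ s ∈ Icc (0:ℝ) 1, ∀ t ∈ Icc (0:ℝ) 1, s ≤ t → φ t - φ s ≤ L * (t - s) := by
    intro s hs t ht hst
    have := variationOnFromTo.add hbv m0 hs ht
    have e : φ t - φ s = variationOnFromTo f (Icc 0 1) s t := by
      rw [hφ]; linarith
    rw [e, variationOnFromTo.eq_of_le _ _ hst]
    have h1 := hlip.comp_eVariationOn_le (g := id) (s := Icc 0 1 ∩ Icc s t) (fun x hx => hx.1)
    have h2 : eVariationOn (id : ℝ → ℝ) (Icc 0 1 ∩ Icc s t) ≤ ENNReal.ofReal (t - s) :=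
      ((monotone_id.monotoneOn (Icc 0 1)).eVariationOn_eq hs ht).le
    refine ENNReal.toReal_le_of_le_ofReal (mul_nonneg hL (sub_nonneg.2 hst)) ?_
    rw [ENNReal.ofReal_mul hL]
    exact h1.trans (mul_le_mul' le_rfl h2)
  have hcont : ContinuousOn φ (Icc 0 1) := by
    have : LipschitzOnWith L.toNNReal φ (Icc 0 1) := by
      refine LipschitzOnWith.of_dist_le_mul fun s hs t ht => ?_
      rw [Real.coe_toNNReal _ hL, Real.dist_eq, Real.dist_eq]
      rcases le_total s t with h | h
      · rw [abs_sub_comm, abs_of_nonneg (sub_nonneg.2 (hmono hs ht h)), abs_sub_comm,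
          abs_of_nonneg (sub_nonneg.2 h)]; exact hstep s hs t ht h
      · rw [abs_of_nonneg (sub_nonneg.2 (hmono ht hs h)),
          abs_of_nonneg (sub_nonneg.2 h)]; exact hstep t ht s hs h
    exact this.continuousOn
  have himg : φ '' Icc 0 1 = Icc 0 (φ 1) := by
    apply Subset.antisymm
    · rintro _ ⟨s, hs, rfl⟩
      exact ⟨hφ0 ▸ hmono m0 hs hs.1, hmono hs m1 hs.2⟩
    · have := intermediate_value_Icc zero_le_one hcont
      rwa [hφ0] at this
  have hus := has_unit_speed_naturalParameterization f hbv m0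
  have hval : ∀ s ∈ Icc (0:ℝ) 1, naturalParameterization f (Icc 0 1) 0 (φ s) = f s := fun s hs =>
    edist_eq_zero.1 (edist_naturalParameterization_eq_zero hbv m0 hs)
  rw [← hφ, himg] at hus
  refine ⟨⟨φ 1, hφ0 ▸ hmono m0 m1 zero_le_one, naturalParameterization f (Icc 0 1) 0, ?_⟩, ?_, ?_, ?_, ?_⟩
  · intro s t hs ht hst
    have := hus hs ht
    rw [inter_eq_self_of_subset_right (Icc_subset_Icc hs.1 ht.2)] at this
    simpa using this
  · intro a ha b hb hab
    dsimp only at ha hb hab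
    rw [← himg] at ha hb
    obtain ⟨s, hs, rfl⟩ := ha
    obtain ⟨t, ht, rfl⟩ := hb
    rw [hval s hs, hval t ht] at hab
    rw [hinj hs ht hab]
  · have := hval 0 m0
    rwa [hφ0] at this
  · exact hval 1 m1
  · rintro _ ⟨a, ha, rfl⟩
    dsimp only at ha ⊢
    rw [← himg] at ha
    obtain ⟨s, hs, rfl⟩ := ha
    rw [hval s hs]
    exact hA s hs

theorem LC.exists_simple {X : Type*} [MetricSpace X] {A : Set X} {x y : X} (h : LC A x y)
    (hxy : x ≠ y) :
    ∃ γ : MCurve X, γ.IsSimple ∧ γ.toFun 0 = x ∧ γ.toFun γ.len = y ∧ γ.image ⊆ A := by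
  obtain ⟨L₀, f, hL, h0, h1, hA, hf⟩ := h
  have m0 : (0:ℝ) ∈ Icc (0:ℝ) 1 := by simp
  have m1 : (1:ℝ) ∈ Icc (0:ℝ) 1 := by simp
  set K := f '' Icc 0 1 with hK
  have hKc : IsCompact K := by
    refine isCompact_Icc.image_of_continuousOn ?_
    have : LipschitzOnWith L₀.toNNReal f (Icc 0 1) := by
      refine LipschitzOnWith.of_dist_le_mul fun s hs t ht => ?_
      rw [Real.coe_toNNReal _ hL, Real.dist_eq]
      rcases le_total s t with h | h
      · rw [abs_sub_comm, abs_of_nonneg (sub_nonneg.2 h)]; exact hf s hs t ht h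
      · rw [dist_comm, abs_of_nonneg (sub_nonneg.2 h)]; exact hf t ht s hs h
    exact this.continuousOn
  let T : Set (ℝ × (ℝ → X)) := (Icc 0 L₀ ×ˢ Set.pi univ (fun _ => K)) ∩
    ({p | p.2 0 = x} ∩ {p | p.2 1 = y} ∩ {p | ∀ s ∈ Icc (0:ℝ) 1, ∀ t ∈ Icc (0:ℝ) 1, s ≤ t →
      dist (p.2 s) (p.2 t) ≤ p.1 * (t - s)})
  have hev : ∀ s : ℝ, Continuous fun p : ℝ × (ℝ → X) => p.2 s := fun s =>
    (continuous_apply s).comp continuous_snd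
  have hTc : IsCompact T := by
    refine (isCompact_Icc.prod (isCompact_univ_pi fun _ => hKc)).inter_right ?_
    refine ((isClosed_eq (hev 0) continuous_const).inter (isClosed_eq (hev 1) continuous_const)).inter ?_
    simp only [ofPred_forall]
    refine isClosed_iInter fun s => isClosed_iInter fun _ => isClosed_iInter fun t =>
      isClosed_iInter fun _ => isClosed_iInter fun _ => ?_
    exact isClosed_le ((hev s).dist (hev t)) (continuous_fst.mul continuous_const)
  have hTn : T.Nonempty := by
    refine ⟨(L₀, fun s => f (projIcc 0 1 zero_le_one s)), ⟨⟨hL, le_rfl⟩, fun s _ =>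
      ⟨_, (projIcc 0 1 zero_le_one s).2, rfl⟩⟩, ⟨?_, ?_⟩, ?_⟩
    · simpa using h0
    · simpa using h1
    · intro s hs t ht hst
      simp only [projIcc_of_mem _ hs, projIcc_of_mem _ ht]
      exact hf s hs t ht hst
  obtain ⟨⟨L, g⟩, ⟨⟨hL0, hgK⟩, ⟨hg0, hg1⟩, hg⟩, hmin⟩ := hTc.exists_isMinOn hTn continuousOn_fst
  dsimp only at hL0 hgK hg0 hg1 hg
  simp only [mem_ofPred_eq] at hg0 hg1 hg
  have hLpos : 0 < L := by
    have := hg 0 m0 1 m1 zero_le_one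
    rw [hg0, hg1] at this
    have := dist_pos.2 hxy
    linarith
  have key : ∀ s ∈ Icc (0:ℝ) 1, ∀ t ∈ Icc (0:ℝ) 1, s < t → g s ≠ g t := by
    intro s hs t ht hst heq
    set c := 1 - (t - s) with hc
    have hc0 : 0 ≤ c := by linarith [hs.1, ht.2]
    have hc1 : c < 1 := by linarith
    have : (L * c, fun r => if c * r ≤ s then g (c * r) else g (c * r + (t - s))) ∈ T := by
      refine ⟨⟨⟨mul_nonneg hL0.1 hc0, ?_⟩, fun r _ => ?_⟩, ⟨?_, ?_⟩, ?_⟩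
      · show L * c ≤ L₀
        nlinarith [hL0.2]
      · dsimp only
        split_ifs
        · exact hgK _ trivial
        · exact hgK _ trivial
      · show (if c * 0 ≤ s then g (c * 0) else g (c * 0 + (t - s))) = x
        rw [mul_zero, if_pos hs.1, hg0]
      · show (if c * 1 ≤ s then g (c * 1) else g (c * 1 + (t - s))) = y
        split_ifs with h
        · have ht1 : t = 1 := by linarith [ht.2]
          rw [show c * 1 = s by rw [hc, ht1]; ring, heq, ht1, hg1]
        · rw [show c * 1 + (t - s) = 1 by rw [hc]; ring, hg1]
      · intro a ha b hb hab
        have i1 : c * a ≤ c * b := mul_le_mul_of_nonneg_left hab hc0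
        have i2 : 0 ≤ c * a := mul_nonneg hc0 ha.1
        have i3 : c * b ≤ c := mul_le_of_le_one_right hc0 hb.2
        dsimp only
        split_ifs with h1 h2 h2
        · refine (hg _ ⟨i2, by linarith⟩ _ ⟨by linarith, by linarith⟩ i1).trans (le_of_eq (by ring))
        · push Not at h2
          have e1 := hg _ ⟨i2, by linarith⟩ s hs h1
          have e2 := hg t ht (c * b + (t - s)) ⟨by linarith, by linarith⟩ (by linarith)
          rw [← heq] at e2
          refine (dist_triangle _ (g s) _).trans ?_
          nlinarith
        · exact absurd (i1.trans h2) h1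
        · refine (hg _ ⟨by linarith, by linarith⟩ _ ⟨by linarith, by linarith⟩ (by linarith)).trans
            (le_of_eq (by ring))
    have h2 : L ≤ L * c := hmin this
    nlinarith
  have hinj : InjOn g (Icc 0 1) := by
    intro s hs t ht hst
    rcases lt_trichotomy s t with h | h | h
    · exact absurd hst (key s hs t ht h)
    · exact h
    · exact absurd hst.symm (key t ht s hs h)
  obtain ⟨γ, a, b, c, d⟩ := exists_curve_of_inj (A := A) L g hL0.1 (fun s hs => by
    obtain ⟨r, hr, e⟩ := hgK s trivial
    rw [← e]; exact hA r hr) hg hinj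
  exact ⟨γ, a, b.trans hg0, c.trans hg1, d⟩

/-- a simple curve inside `U` along which `v` jumps -/
def JumpIn {X : Type*} [MetricSpace X] (v : X → ℝ) (D U : Set X) : Prop :=
  ∃ γ : MCurve X, γ.IsSimple ∧ γ.image ⊆ U ∧ γ.toFun 0 ∈ D ∧ γ.toFun γ.len ∈ D ∧
    v (γ.toFun 0) ≠ v (γ.toFun γ.len)

/-- the jump set -/
def JS {X : Type*} [MetricSpace X] (v : X → ℝ) (D : Set X) : Set X :=
  {x | ∀ U ∈ 𝓝 x, JumpIn v D U}

theorem JS_card {X : Type*} [MetricSpace X] {v : X → ℝ} {D : Set X}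
    (hD : ∀ x ∈ D, v x = 0 ∨ v x = 1) (F : Finset X) (hF : (F : Set X) ⊆ JS v D) :
    (F.card : ℝ≥0∞) ≤ pVar v := by
  obtain ⟨U, hU, hdis⟩ := F.finite_toSet.t2_separation
  have hj : ∀ x : F, JumpIn v D (U x) := fun x => hF x.2 _ ((hU x).2.mem_nhds (hU x).1)
  choose γ hs hi h0 h1 hne using hj
  let e := F.equivFin
  have hd : ∀ i j, i ≠ j → Disjoint (γ (e.symm i)).image (γ (e.symm j)).image := by
    intro i j hij
    refine (hdis (e.symm i).2 (e.symm j).2 ?_).mono (hi _) (hi _)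
    intro h
    exact hij (e.symm.injective (Subtype.ext h))
  have hsum : ∑ i, ENNReal.ofReal |v ((γ (e.symm i)).toFun (γ (e.symm i)).len)
      - v ((γ (e.symm i)).toFun 0)| = (F.card : ℝ≥0∞) := by
    rw [Finset.sum_congr rfl (g := fun _ => (1 : ℝ≥0∞))]
    · simp
    · intro i _
      have a := hD _ (h0 (e.symm i))
      have b := hD _ (h1 (e.symm i))
      have c := hne (e.symm i)
      rcases a with a | a <;> rcases b with b | b <;> rw [a, b] at c <;> rw [a, b] <;> simp at c ⊢
  rw [← hsum, pVar]
  exact le_iSup_of_le F.card (le_iSup_of_le (fun i => γ (e.symm i))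
    (le_iSup_of_le (fun i => hs _) (le_iSup_of_le hd le_rfl)))

theorem curve_pos {X : Type*} [MetricSpace X] [MeasurableSpace X] [BorelSpace X]
    (γ : MCurve X) (hs : γ.IsSimple) {a b : ℝ} (ha : a ∈ Icc 0 γ.len) (hb : b ∈ Icc 0 γ.len)
    (hab : a < b) : 0 < μH[1] (γ.toFun '' Icc a b) := by
  have hne : γ.toFun a ≠ γ.toFun b := fun h => hab.ne (hs ha hb h)
  have hsub : Icc a b ⊆ Icc 0 γ.len := Icc_subset_Icc ha.1 hb.2
  have hlip : LipschitzWith 1 (fun x => dist x (γ.toFun a)) := LipschitzWith.dist_left _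
  have h1 := (hlip.lipschitzOnWith (s := γ.toFun '' Icc a b)).hausdorffMeasure_image_le
    (d := 1) zero_le_one
  have hc : ContinuousOn (fun s => dist (γ.toFun s) (γ.toFun a)) (Icc a b) :=
    hlip.continuous.comp_continuousOn (γ.lip.continuousOn.mono hsub)
  have h2 := intermediate_value_Icc hab.le hc
  rw [hausdorffMeasure_real, image_image] at h1
  have h3 := (measure_mono (μ := volume) h2).trans h1
  simp only [dist_self, Real.volume_Icc, sub_zero, ENNReal.coe_one,
    ENNReal.one_rpow, one_mul] at h3
  refine lt_of_lt_of_le ?_ h3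
  exact ENNReal.ofReal_pos.2 (dist_pos.2 hne.symm)

theorem curve_const {X : Type*} [MetricSpace X] [MeasurableSpace X] [BorelSpace X]
    {v : X → ℝ} {D : Set X} (hnull : μH[1] Dᶜ = 0)
    (γ : MCurve X) (hs : γ.IsSimple) (hi : γ.image ⊆ (JS v D)ᶜ)
    (h0 : γ.toFun 0 ∈ D) (h1 : γ.toFun γ.len ∈ D) : v (γ.toFun 0) = v (γ.toFun γ.len) := by
  by_contra hne
  have hlen : 0 < γ.len := by
    rcases γ.len_nonneg.eq_or_lt with h | h
    · rw [← h] at hne; exact absurd rfl hne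
    · exact h
  set D' : Set ℝ := {s | s ∈ Icc 0 γ.len ∧ γ.toFun s ∈ D} with hD'
  have hdense : ∀ t ∈ Icc 0 γ.len, t ∈ closure D' := by
    intro t ht
    rw [Metric.mem_closure_iff]
    intro ε hε
    by_contra hcon
    push Not at hcon
    have : ∃ a b, a ∈ Icc 0 γ.len ∧ b ∈ Icc 0 γ.len ∧ a < b ∧ ∀ s ∈ Icc a b, |t - s| < ε := by
      rcases ht.2.lt_or_eq with h | h
      · have : 0 < min (ε / 2) (γ.len - t) := lt_min (by linarith) (by linarith)
        have q1 := min_le_left (ε / 2) (γ.len - t)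
        have q2 := min_le_right (ε / 2) (γ.len - t)
        refine ⟨t, t + min (ε/2) (γ.len - t), ht, ⟨by linarith [ht.1], by linarith⟩, by linarith, ?_⟩
        intro s hs
        rw [abs_lt]; constructor <;> linarith [hs.1, hs.2]
      · have : 0 < min (ε / 2) t := lt_min (by linarith) (by linarith)
        have q1 := min_le_left (ε / 2) t
        have q2 := min_le_right (ε / 2) t
        refine ⟨t - min (ε/2) t, t, ⟨by linarith, by linarith⟩, ht, by linarith, ?_⟩
        intro s hs
        rw [abs_lt]; constructor <;> linarith [hs.1, hs.2]
    obtain ⟨a, b, ha, hb, hab, hclose⟩ := this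
    have hp := curve_pos γ hs ha hb hab
    have : γ.toFun '' Icc a b ⊆ Dᶜ := by
      rintro _ ⟨s, hs', rfl⟩ hsD
      have := hcon s ⟨⟨ha.1.trans hs'.1, hs'.2.trans hb.2⟩, hsD⟩
      rw [Real.dist_eq] at this
      exact absurd (hclose s hs') (not_lt.2 this)
    exact absurd (measure_mono_null this hnull) hp.ne'
  -- local constancy
  have hloc : ∀ t ∈ Icc 0 γ.len, ∃ V : Set ℝ, IsOpen V ∧ t ∈ V ∧
      ∀ a ∈ V ∩ D', ∀ b ∈ V ∩ D', v (γ.toFun a) = v (γ.toFun b) := by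
    intro t ht
    have : γ.toFun t ∉ JS v D := hi ⟨t, ht, rfl⟩
    simp only [JS, mem_ofPred_eq, not_forall] at this
    obtain ⟨U, hU, hUj⟩ := this
    have hc : γ.toFun ⁻¹' U ∈ 𝓝[Icc 0 γ.len] t := γ.lip.continuousOn t ht hU
    obtain ⟨ε, hε, hsub⟩ := Metric.mem_nhdsWithin_iff.1 hc
    have key : ∀ a ∈ Metric.ball t ε ∩ D', ∀ b ∈ Metric.ball t ε ∩ D', a ≤ b →
        v (γ.toFun a) = v (γ.toFun b) := by
      intro a ha b hb hab
      by_contra hcon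
      apply hUj
      refine ⟨γ.sub a b ha.2.1.1 hab hb.2.1.2, ?_, ?_, ?_, ?_, ?_⟩
      · intro p hp q hq hpq
        have hp' : p ∈ Icc 0 (b - a) := hp
        have hq' : q ∈ Icc 0 (b - a) := hq
        have := hs (x₁ := p + a) (x₂ := q + a) ⟨by linarith [hp'.1, ha.2.1.1], by linarith [hp'.2, hb.2.1.2]⟩
          ⟨by linarith [hq'.1, ha.2.1.1], by linarith [hq'.2, hb.2.1.2]⟩ hpq
        linarith
      · rintro _ ⟨p, hp, rfl⟩
        have hp' : p ∈ Icc 0 (b - a) := hp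
        refine hsub (a := p + a) ⟨?_, ⟨by linarith [hp'.1, ha.2.1.1], by linarith [hp'.2, hb.2.1.2]⟩⟩
        have e1 := ha.1
        have e2 := hb.1
        rw [Real.ball_eq_Ioo] at e1 e2 ⊢
        exact ⟨by linarith [e1.1, hp'.1], by linarith [e2.2, hp'.2]⟩
      · simpa [MCurve.sub] using ha.2.2
      · simpa [MCurve.sub] using hb.2.2
      · simpa [MCurve.sub] using hcon
    refine ⟨Metric.ball t ε, Metric.isOpen_ball, Metric.mem_ball_self hε, fun a ha b hb => ?_⟩
    rcases le_total a b with h | h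
    · exact key a ha b hb h
    · exact (key b hb a ha h).symm
  set c := v (γ.toFun 0) with hc
  let B1 : Set ℝ := ⋃₀ {V | IsOpen V ∧ ∀ a ∈ V ∩ D', v (γ.toFun a) = c}
  let B2 : Set ℝ := ⋃₀ {V | IsOpen V ∧ ∀ a ∈ V ∩ D', v (γ.toFun a) ≠ c}
  have hB1 : IsOpen B1 := isOpen_sUnion fun V hV => hV.1
  have hB2 : IsOpen B2 := isOpen_sUnion fun V hV => hV.1
  have m0 : (0:ℝ) ∈ Icc 0 γ.len := ⟨le_rfl, hlen.le⟩
  have m1 : γ.len ∈ Icc 0 γ.len := ⟨hlen.le, le_rfl⟩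
  have hcov : Icc 0 γ.len ⊆ B1 ∪ B2 := by
    intro t ht
    obtain ⟨V, hV, htV, hVc⟩ := hloc t ht
    obtain ⟨a, haV, haD⟩ := mem_closure_iff.1 (hdense t ht) V hV htV
    by_cases h : v (γ.toFun a) = c
    · left
      exact ⟨V, ⟨hV, fun b hb => (hVc b hb a ⟨haV, haD⟩).trans h⟩, htV⟩
    · right
      exact ⟨V, ⟨hV, fun b hb => (hVc b hb a ⟨haV, haD⟩).trans_ne h⟩, htV⟩
  have n1 : (Icc 0 γ.len ∩ B1).Nonempty := by
    obtain ⟨V, hV, htV, hVc⟩ := hloc 0 m0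
    exact ⟨0, m0, V, ⟨hV, fun b hb => hVc b hb 0 ⟨htV, m0, h0⟩⟩, htV⟩
  have n2 : (Icc 0 γ.len ∩ B2).Nonempty := by
    obtain ⟨V, hV, htV, hVc⟩ := hloc γ.len m1
    exact ⟨γ.len, m1, V, ⟨hV, fun b hb => (hVc b hb γ.len ⟨htV, m1, h1⟩).trans_ne (Ne.symm hne)⟩, htV⟩
  obtain ⟨t, ht, ⟨V, hV, htV⟩, ⟨W, hW, htW⟩⟩ := isPreconnected_Icc B1 B2 hB1 hB2 hcov n1 n2
  obtain ⟨a, haV, haD⟩ := mem_closure_iff.1 (hdense t ht) (V ∩ W) (hV.1.inter hW.1) ⟨htV, htW⟩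
  exact hW.2 a ⟨haV.2, haD⟩ (hV.2 a ⟨haV.1, haD⟩)

/-- tent function -/
noncomputable def tent {X : Type*} [MetricSpace X] (x₀ : X) (r : ℝ) (x : X) : ℝ :=
  max 0 (1 - dist x x₀ / r)

theorem tent_ug {X : Type*} [MetricSpace X] (x₀ : X) {r : ℝ} (hr : 0 < r) (γ : MCurve X)
    {a b : ℝ} (ha : 0 ≤ a) (hab : a ≤ b) (hb : b ≤ γ.len) :
    ENNReal.ofReal |tent x₀ r (γ.toFun b) - tent x₀ r (γ.toFun a)| ≤
      ∫⁻ s in Icc a b, (Metric.ball x₀ r).indicator (fun _ => (ENNReal.ofReal r)⁻¹) (γ.toFun s) := by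
  have hsub : Icc a b ⊆ Icc 0 γ.len := Icc_subset_Icc ha hb
  have hcont : ContinuousOn γ.toFun (Icc a b) := γ.lip.continuousOn.mono hsub
  set T := Icc a b ∩ γ.toFun ⁻¹' (Metric.ball x₀ r) with hT
  have hTm : MeasurableSet T := by
    obtain ⟨U, hU, he⟩ := continuousOn_iff'.1 hcont _ (Metric.isOpen_ball (x := x₀) (ε := r))
    rw [hT, inter_comm, he]
    exact hU.measurableSet.inter measurableSet_Icc
  set h : ℝ → ℝ := fun s => tent x₀ r (γ.toFun s) with hh
  have hlip : LipschitzOnWith (r⁻¹).toNNReal h (Icc a b) := by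
    refine LipschitzOnWith.of_dist_le_mul fun s hs t ht => ?_
    rw [Real.coe_toNNReal _ (inv_nonneg.2 hr.le), Real.dist_eq, Real.dist_eq]
    refine (abs_max_sub_max_le_max _ _ _ _).trans ?_
    rw [sub_self, abs_zero, max_eq_right (abs_nonneg _)]
    rw [show (1 - dist (γ.toFun s) x₀ / r) - (1 - dist (γ.toFun t) x₀ / r) =
      r⁻¹ * (dist (γ.toFun t) x₀ - dist (γ.toFun s) x₀) by ring, abs_mul,
      abs_of_nonneg (inv_nonneg.2 hr.le)]
    refine mul_le_mul_of_nonneg_left ?_ (inv_nonneg.2 hr.le)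
    refine (abs_dist_sub_le _ _ _).trans ?_
    rw [dist_comm]
    exact γ.dist_le (hsub hs) (hsub ht)
  have hiv : uIcc (h a) (h b) ⊆ h '' Icc a b := by
    have := intermediate_value_uIcc (f := h) (a := a) (b := b) (by rw [uIcc_of_le hab]; exact hlip.continuousOn)
    rwa [uIcc_of_le hab] at this
  have hsubT : Ioo (min (h a) (h b)) (max (h a) (h b)) ⊆ h '' T := by
    intro y hy
    obtain ⟨s, hs, rfl⟩ := hiv (Ioo_subset_Icc_self hy)
    refine ⟨s, ⟨hs, ?_⟩, rfl⟩
    have hpos : 0 < h s := lt_of_le_of_lt (le_min (le_max_left _ _) (le_max_left _ _)) hy.1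
    rw [hh] at hpos
    simp only [tent, lt_max_iff, lt_irrefl, false_or, sub_pos] at hpos
    rw [div_lt_one hr] at hpos
    exact hpos
  have h1 := (hlip.mono (inter_subset_left : T ⊆ _)).hausdorffMeasure_image_le (d := 1) zero_le_one
  rw [hausdorffMeasure_real] at h1
  have h2 := (measure_mono (μ := volume) hsubT).trans h1
  rw [Real.volume_Ioo, max_sub_min_eq_abs, ENNReal.rpow_one] at h2
  refine h2.trans ?_
  have e : (((r⁻¹).toNNReal : NNReal) : ℝ≥0∞) = (ENNReal.ofReal r)⁻¹ := by
    rw [← ENNReal.ofReal_inv_of_pos hr]; rfl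
  rw [e]
  calc (ENNReal.ofReal r)⁻¹ * volume T = ∫⁻ s in T, (ENNReal.ofReal r)⁻¹ := by
        rw [setLIntegral_const]
    _ = ∫⁻ s in T, (Metric.ball x₀ r).indicator (fun _ => (ENNReal.ofReal r)⁻¹) (γ.toFun s) := by
        refine setLIntegral_congr_fun hTm fun s hs => ?_
        have hm : γ.toFun s ∈ Metric.ball x₀ r := hs.2
        rw [indicator_of_mem hm]
    _ ≤ _ := lintegral_mono_set inter_subset_left

theorem tent_nonneg {X : Type*} [MetricSpace X] (x₀ : X) (r : ℝ) (x : X) : 0 ≤ tent x₀ r x :=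
  le_max_left _ _

theorem tent_self {X : Type*} [MetricSpace X] (x₀ : X) (r : ℝ) : tent x₀ r x₀ = 1 := by
  simp [tent]

theorem tent_le_ind {X : Type*} [MetricSpace X] (x₀ : X) {r : ℝ} (hr : 0 < r) (x : X) :
    ENNReal.ofReal (tent x₀ r x) ≤ (Metric.ball x₀ r).indicator (fun _ => (1 : ℝ≥0∞)) x := by
  by_cases h : x ∈ Metric.ball x₀ r
  · rw [indicator_of_mem h, ENNReal.ofReal_le_one]
    exact max_le zero_le_one (by have := div_nonneg (dist_nonneg (x := x) (y := x₀)) hr.le; linarith)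
  · rw [indicator_of_notMem h]
    rw [Metric.mem_ball, not_lt] at h
    rw [nonpos_iff_eq_zero, ENNReal.ofReal_eq_zero]
    refine max_le le_rfl ?_
    have := (one_le_div hr).2 h
    linarith

/-- cutoff vanishing on `F` -/
noncomputable def cut {X : Type*} [MetricSpace X] (F : Finset X) (r : X → ℝ) (x : X) : ℝ :=
  max 0 (1 - ∑ k ∈ F, tent k (r k) x)

/-- its upper gradient -/
noncomputable def cutg {X : Type*} [MetricSpace X] (F : Finset X) (r : X → ℝ) (x : X) : ℝ≥0∞ :=
  ∑ k ∈ F, (Metric.ball k (r k)).indicator (fun _ => (ENNReal.ofReal (r k))⁻¹) x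

theorem cut_nonneg {X : Type*} [MetricSpace X] (F : Finset X) (r : X → ℝ) (x : X) :
    0 ≤ cut F r x := le_max_left _ _

theorem cut_le_one {X : Type*} [MetricSpace X] (F : Finset X) (r : X → ℝ) (x : X) :
    cut F r x ≤ 1 :=
  max_le zero_le_one (by
    have := Finset.sum_nonneg (s := F) fun k _ => tent_nonneg k (r k) x
    linarith)

theorem cut_mem {X : Type*} [MetricSpace X] {F : Finset X} (r : X → ℝ) {x : X} (hx : x ∈ F) :
    cut F r x = 0 := by
  refine max_eq_left ?_
  have := Finset.single_le_sum (f := fun k => tent k (r k) x) (fun k _ => tent_nonneg k (r k) x) hx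
  simp only [tent_self] at this
  linarith

theorem one_sub_cut_le {X : Type*} [MetricSpace X] (F : Finset X) {r : X → ℝ} (hr : ∀ k, 0 < r k)
    (x : X) : ENNReal.ofReal (1 - cut F r x) ≤
      ∑ k ∈ F, (Metric.ball k (r k)).indicator (fun _ => (1 : ℝ≥0∞)) x := by
  calc ENNReal.ofReal (1 - cut F r x) ≤ ENNReal.ofReal (∑ k ∈ F, tent k (r k) x) := by
        refine ENNReal.ofReal_le_ofReal ?_
        have : 1 - ∑ k ∈ F, tent k (r k) x ≤ cut F r x := le_max_right _ _
        linarith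
    _ = ∑ k ∈ F, ENNReal.ofReal (tent k (r k) x) :=
        ENNReal.ofReal_sum_of_nonneg fun k _ => tent_nonneg _ _ _
    _ ≤ _ := Finset.sum_le_sum fun k _ => tent_le_ind k (hr k) x

theorem cut_ug {X : Type*} [MetricSpace X] (F : Finset X) {r : X → ℝ} (hr : ∀ k, 0 < r k)
    (γ : MCurve X) {a b : ℝ} (ha : 0 ≤ a) (hab : a ≤ b) (hb : b ≤ γ.len) :
    ENNReal.ofReal |cut F r (γ.toFun b) - cut F r (γ.toFun a)| ≤
      ∫⁻ s in Icc 0 γ.len, cutg F r (γ.toFun s) := by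
  have hcont : ContinuousOn γ.toFun (Icc a b) :=
    γ.lip.continuousOn.mono (Icc_subset_Icc ha hb)
  calc ENNReal.ofReal |cut F r (γ.toFun b) - cut F r (γ.toFun a)|
      ≤ ENNReal.ofReal (∑ k ∈ F, |tent k (r k) (γ.toFun b) - tent k (r k) (γ.toFun a)|) := by
        refine ENNReal.ofReal_le_ofReal ?_
        refine (abs_max_sub_max_le_max _ _ _ _).trans ?_
        rw [sub_self, abs_zero, max_eq_right (abs_nonneg _), abs_sub_comm,
          show ∀ p q : ℝ, 1 - p - (1 - q) = q - p from fun p q => by ring, ← Finset.sum_sub_distrib]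
        exact Finset.abs_sum_le_sum_abs _ _
    _ = ∑ k ∈ F, ENNReal.ofReal |tent k (r k) (γ.toFun b) - tent k (r k) (γ.toFun a)| :=
        ENNReal.ofReal_sum_of_nonneg fun k _ => abs_nonneg _
    _ ≤ ∑ k ∈ F, ∫⁻ s in Icc a b,
          (Metric.ball k (r k)).indicator (fun _ => (ENNReal.ofReal (r k))⁻¹) (γ.toFun s) :=
        Finset.sum_le_sum fun k _ => tent_ug k (hr k) γ ha hab hb
    _ = ∫⁻ s in Icc a b, cutg F r (γ.toFun s) := by
        simp only [cutg]
        rw [lintegral_finsetSum']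
        intro k _
        let : MeasurableSpace X := borel X
        have : BorelSpace X := ⟨rfl⟩
        have h1 : Measurable ((Metric.ball k (r k)).indicator
            (fun _ : X => (ENNReal.ofReal (r k))⁻¹)) :=
          measurable_const.indicator Metric.isOpen_ball.measurableSet
        exact h1.comp_aemeasurable (hcont.aemeasurable measurableSet_Icc)
    _ ≤ _ := lintegral_mono_set (Icc_subset_Icc ha hb)

theorem main_v {X : Type*} [MetricSpace X] [MeasurableSpace X] [BorelSpace X]
    (C₀ : ℝ) (hC₀ : 0 < C₀)
    (hdens : ∀ x : X, Filter.liminf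
      (fun r : ℝ => μH[1] (Metric.ball x r) / ENNReal.ofReal r) (𝓝[>] 0)
      < ENNReal.ofReal C₀)
    (E : Set X) (v : X → ℝ) (hv : v =ᵐ[μH[1]] Set.indicator E (fun _ => (1 : ℝ))) :
    totalVarH (μH[1]) (Set.indicator E (fun _ => (1 : ℝ))) ≤ ENNReal.ofReal C₀ * pVar v := by
  classical
  by_cases hfin : pVar v = ⊤
  · rw [hfin, ENNReal.mul_top (ENNReal.ofReal_pos.2 hC₀).ne']
    exact le_top
  set χ : X → ℝ := Set.indicator E (fun _ => (1 : ℝ)) with hχ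
  set D : Set X := {x | v x = χ x} with hDdef
  have hnull : μH[1] Dᶜ = 0 := hv
  have hD : ∀ x ∈ D, v x = 0 ∨ v x = 1 := by
    intro x hx
    have : v x = χ x := hx
    rw [this, hχ]
    by_cases h : x ∈ E
    · right; simp [h]
    · left; simp [h]
  have hSfin : (JS v D).Finite := by
    by_contra hinf
    obtain ⟨n, hn⟩ := ENNReal.exists_nat_gt hfin
    obtain ⟨F, hF, hc⟩ := Set.Infinite.exists_subset_card_eq hinf n
    have := JS_card hD F hF
    rw [hc] at this
    exact absurd hn (not_lt.2 this)
  set F := hSfin.toFinset with hFdef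
  have hFS : (F : Set X) = JS v D := by simp [hFdef]
  have hcard : (F.card : ℝ≥0∞) ≤ pVar v := JS_card hD F hFS.le
  have hconst : ∀ x ∈ D, ∀ y ∈ D, LC (JS v D)ᶜ x y → v x = v y := by
    intro x hx y hy h
    by_contra hne
    obtain ⟨γ, hs, e0, e1, hi⟩ := h.exists_simple (fun e => hne (by rw [e]))
    have := curve_const hnull γ hs hi (by rwa [e0]) (by rwa [e1])
    rw [e0, e1] at this
    exact hne this
  let P : Set X := {x | ∃ y ∈ D, v y = 1 ∧ LC (JS v D)ᶜ y x}
  let w : X → ℝ := fun x => if x ∈ JS v D then χ x else P.indicator (fun _ => (1 : ℝ)) x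
  have hw01 : ∀ x, w x = 0 ∨ w x = 1 := by
    intro x
    by_cases h : x ∈ JS v D <;> by_cases h' : x ∈ P <;> by_cases h'' : x ∈ E <;>
      simp [w, h, h', h'', hχ]
  have hwD : ∀ x ∈ D, w x = χ x := by
    intro x hx
    by_cases h : x ∈ JS v D
    · simp [w, h]
    · have hxv : v x = χ x := hx
      rw [← hxv]
      simp only [w, if_neg h]
      rcases hD x hx with h0 | h1
      · rw [h0, indicator_of_notMem]
        rintro ⟨y, hy, hy1, hl⟩
        have := hconst y hy x hx hl
        rw [h0, hy1] at this
        exact one_ne_zero this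
      · rw [h1, indicator_of_mem]
        exact ⟨x, hx, h1, LC.refl h⟩
  have hwγ : ∀ x y, x ∉ JS v D → y ∉ JS v D → LC (JS v D)ᶜ x y → w x = w y := by
    intro x y hx hy h
    simp only [w, if_neg hx, if_neg hy]
    have : x ∈ P ↔ y ∈ P := by
      constructor
      · rintro ⟨z, hz, hz1, hl⟩
        exact ⟨z, hz, hz1, hl.trans h⟩
      · rintro ⟨z, hz, hz1, hl⟩
        exact ⟨z, hz, hz1, hl.trans h.symm⟩
    by_cases hxP : x ∈ P
    · rw [indicator_of_mem hxP, indicator_of_mem (this.1 hxP)]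
    · rw [indicator_of_notMem hxP, indicator_of_notMem (fun h => hxP (this.2 h))]
  have hrad : ∀ (i : ℕ) (x : X), ∃ r : ℝ, 0 < r ∧ r < 1 / ((i : ℝ) + 1) ∧
      μH[1] (Metric.ball x r) / ENNReal.ofReal r < ENNReal.ofReal C₀ := by
    intro i x
    have h1 := Filter.frequently_lt_of_liminf_lt (h := hdens x)
    have h2 : ∀ᶠ r : ℝ in 𝓝[>] 0, r ∈ Ioo (0:ℝ) (1 / ((i : ℝ) + 1)) :=
      Ioo_mem_nhdsGT (by positivity)
    obtain ⟨r, hr, hr2⟩ := (h1.and_eventually h2).exists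
    exact ⟨r, hr2.1, hr2.2, hr⟩
  choose r hr0 hr1 hrd using hrad
  have hball : ∀ i k, μH[1] (Metric.ball k (r i k)) ≤ ENNReal.ofReal C₀ * ENNReal.ofReal (r i k) := by
    intro i k
    exact (ENNReal.div_le_iff (ENNReal.ofReal_pos.2 (hr0 i k)).ne' ENNReal.ofReal_ne_top).1 (hrd i k).le
  have hug : ∀ i, IsUpperGradient (fun x => w x * cut F (r i) x) (cutg F (r i)) := by
    intro i
    refine ⟨?_, fun γ => ?_⟩
    · exact Finset.measurable_fun_sum _ fun k _ =>
        measurable_const.indicator Metric.isOpen_ball.measurableSet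
    · dsimp only
      by_cases hmeet : ∃ t ∈ Icc 0 γ.len, γ.toFun t ∈ JS v D
      · obtain ⟨t, ht, htS⟩ := hmeet
        have hz : cut F (r i) (γ.toFun t) = 0 := cut_mem _ (by rw [← Finset.mem_coe, hFS]; exact htS)
        have k1 := cut_ug F (hr0 i) γ le_rfl ht.1 ht.2
        have k2 := cut_ug F (hr0 i) γ ht.1 ht.2 le_rfl
        rw [hz, zero_sub, abs_neg, abs_of_nonneg (cut_nonneg _ _ _)] at k1
        rw [hz, sub_zero, abs_of_nonneg (cut_nonneg _ _ _)] at k2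
        have c1 := cut_nonneg F (r i) (γ.toFun 0)
        have c2 := cut_nonneg F (r i) (γ.toFun γ.len)
        have : |w (γ.toFun γ.len) * cut F (r i) (γ.toFun γ.len) -
            w (γ.toFun 0) * cut F (r i) (γ.toFun 0)| ≤
            max (cut F (r i) (γ.toFun 0)) (cut F (r i) (γ.toFun γ.len)) := by
          have d1 := le_max_left (cut F (r i) (γ.toFun 0)) (cut F (r i) (γ.toFun γ.len))
          have d2 := le_max_right (cut F (r i) (γ.toFun 0)) (cut F (r i) (γ.toFun γ.len))
          rcases hw01 (γ.toFun γ.len) with h | h <;> rcases hw01 (γ.toFun 0) with h' | h' <;>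
            rw [h, h', abs_le] <;> constructor <;> linarith
        refine (ENNReal.ofReal_le_ofReal this).trans ?_
        rcases max_choice (cut F (r i) (γ.toFun 0)) (cut F (r i) (γ.toFun γ.len)) with h | h <;> rw [h]
        · exact k1
        · exact k2
      · push Not at hmeet
        have m0 : (0:ℝ) ∈ Icc 0 γ.len := ⟨le_rfl, γ.len_nonneg⟩
        have m1 : γ.len ∈ Icc 0 γ.len := ⟨γ.len_nonneg, le_rfl⟩
        have hl : LC (JS v D)ᶜ (γ.toFun 0) (γ.toFun γ.len) :=
          LC.of_curve γ (by rintro _ ⟨t, ht, rfl⟩; exact hmeet t ht)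
        rw [hwγ _ _ (hmeet _ m0) (hmeet _ m1) hl, ← mul_sub, abs_mul]
        refine (ENNReal.ofReal_le_ofReal ?_).trans (cut_ug F (hr0 i) γ le_rfl γ.len_nonneg le_rfl)
        refine mul_le_of_le_one_left (abs_nonneg _) ?_
        rcases hw01 (γ.toFun γ.len) with h | h <;> rw [h] <;> simp
  have hL1 : Filter.Tendsto (fun i => ∫⁻ x, ENNReal.ofReal |w x * cut F (r i) x - χ x| ∂μH[1])
      Filter.atTop (nhds 0) := by
    have hb : ∀ i : ℕ, ∫⁻ x, ENNReal.ofReal |w x * cut F (r i) x - χ x| ∂μH[1] ≤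
        (F.card : ℝ≥0∞) * (ENNReal.ofReal C₀ * ENNReal.ofReal (1 / ((i : ℝ) + 1))) := by
      intro i
      calc ∫⁻ x, ENNReal.ofReal |w x * cut F (r i) x - χ x| ∂μH[1]
          ≤ ∫⁻ x, ∑ k ∈ F, (Metric.ball k (r i k)).indicator (fun _ => (1 : ℝ≥0∞)) x ∂μH[1] := by
            refine lintegral_mono_ae ?_
            filter_upwards [hv] with x hx
            refine le_trans (ENNReal.ofReal_le_ofReal ?_) (one_sub_cut_le F (hr0 i) x)
            rw [← hwD x hx]
            have c1 := cut_nonneg F (r i) x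
            have c2 := cut_le_one F (r i) x
            rcases hw01 x with h | h <;> rw [h, abs_le] <;> constructor <;> linarith
        _ = ∑ k ∈ F, μH[1] (Metric.ball k (r i k)) := by
            rw [lintegral_finsetSum]
            · refine Finset.sum_congr rfl fun k _ => ?_
              rw [lintegral_indicator_const Metric.isOpen_ball.measurableSet, one_mul]
            · exact fun k _ => measurable_const.indicator Metric.isOpen_ball.measurableSet
        _ ≤ ∑ k ∈ F, ENNReal.ofReal C₀ * ENNReal.ofReal (1 / ((i : ℝ) + 1)) := by
            refine Finset.sum_le_sum fun k _ => (hball i k).trans ?_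
            exact mul_le_mul' le_rfl (ENNReal.ofReal_le_ofReal (hr1 i k).le)
        _ = _ := by rw [Finset.sum_const, nsmul_eq_mul]
    refine tendsto_of_tendsto_of_tendsto_of_le_of_le tendsto_const_nhds ?_ (fun _ => zero_le) hb
    have h1 : Tendsto (fun i : ℕ => ENNReal.ofReal (1 / ((i : ℝ) + 1))) atTop (𝓝 0) := by
      simpa using ENNReal.tendsto_ofReal (tendsto_one_div_add_atTop_nhds_zero_nat (𝕜 := ℝ))
    have h2 := ENNReal.Tendsto.const_mul (a := ENNReal.ofReal C₀) h1 (Or.inr ENNReal.ofReal_ne_top)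
    have h3 := ENNReal.Tendsto.const_mul (a := (F.card : ℝ≥0∞)) h2 (Or.inr (ENNReal.natCast_ne_top _))
    simpa using h3
  have hint : ∀ i, ∫⁻ x, cutg F (r i) x ∂μH[1] ≤ ENNReal.ofReal C₀ * pVar v := by
    intro i
    calc ∫⁻ x, cutg F (r i) x ∂μH[1]
        = ∑ k ∈ F, (ENNReal.ofReal (r i k))⁻¹ * μH[1] (Metric.ball k (r i k)) := by
          simp only [cutg]
          rw [lintegral_finsetSum]
          · refine Finset.sum_congr rfl fun k _ => ?_
            rw [lintegral_indicator_const Metric.isOpen_ball.measurableSet]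
          · exact fun k _ => measurable_const.indicator Metric.isOpen_ball.measurableSet
      _ ≤ ∑ k ∈ F, ENNReal.ofReal C₀ := by
          refine Finset.sum_le_sum fun k _ => ?_
          rw [mul_comm, ← div_eq_mul_inv]
          exact (hrd i k).le
      _ = ENNReal.ofReal C₀ * F.card := by rw [Finset.sum_const, nsmul_eq_mul, mul_comm]
      _ ≤ _ := mul_le_mul' le_rfl hcard
  unfold totalVarH
  refine iInf_le_of_le (fun i x => w x * cut F (r i) x) (iInf_le_of_le (fun i => cutg F (r i))
    (iInf_le_of_le hug (iInf_le_of_le hL1 ?_)))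
  calc _ ≤ Filter.atTop.liminf (fun _ : ℕ => ENNReal.ofReal C₀ * pVar v) :=
        liminf_le_liminf (Eventually.of_forall hint)
    _ = _ := liminf_const _

theorem stmt15 {X : Type*} [MetricSpace X] [CompleteSpace X] [ConnectedSpace X]
    [MeasurableSpace X] [BorelSpace X]
    (h0 : 0 < μH[1] (Set.univ : Set X)) (h1 : μH[1] (Set.univ : Set X) < ⊤)
    (C₀ : ℝ) (hC₀ : 0 < C₀)
    (hdens : ∀ x : X, Filter.liminf
      (fun r : ℝ => μH[1] (Metric.ball x r) / ENNReal.ofReal r) (𝓝[>] 0)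
      < ENNReal.ofReal C₀)
    (E : Set X) :
    totalVarH (μH[1]) (Set.indicator E (fun _ => (1 : ℝ)))
      ≤ ENNReal.ofReal C₀ * VarH (μH[1]) (Set.indicator E (fun _ => (1 : ℝ))) := by
  unfold VarH
  have hc := (ENNReal.ofReal_pos.2 hC₀).ne'
  rw [ENNReal.mul_iInf_of_ne hc ENNReal.ofReal_ne_top]
  refine le_iInf fun v => ?_
  rw [ENNReal.mul_iInf_of_ne hc ENNReal.ofReal_ne_top]
  exact le_iInf fun hv => main_v C₀ hC₀ hdens E v hv
end

section
/- Let (X,d) be a complete and connected metric space with 0 < ℋ¹(X) < ∞. Let F ⊂ X satisfy pV(χ_F,X) < ∞, where χ_F is the characteristic function of F. Then the curve boundary ∂^c F is a finite set with at most pV(χ_F,X) points. -/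
open MeasureTheory Set Filter Topology ENNReal

/-- The inner metric: infimum of lengths of curves joining `x` to `y`. -/
noncomputable def innerDist {X : Type*} [MetricSpace X] (x y : X) : ℝ≥0∞ :=
  ⨅ (γ : MCurve X) (_ : γ.toFun 0 = x) (_ : γ.toFun γ.len = y), ENNReal.ofReal γ.len

/-- Ball with respect to the inner metric. -/
def innerBall {X : Type*} [MetricSpace X] (x : X) (δ : ℝ) : Set X :=
  {y | innerDist x y < ENNReal.ofReal δ}

/-- The curve boundary `∂ᶜF`: points `x` such that every inner-metric ball around `x`
contains a curve intersecting both `F` and `X ∖ F`. -/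
def curveBoundary {X : Type*} [MetricSpace X] (F : Set X) : Set X :=
  {x | ∀ δ : ℝ, 0 < δ → ∃ γ : MCurve X, γ.image ⊆ innerBall x δ ∧
    (γ.image ∩ F).Nonempty ∧ (γ.image ∩ Fᶜ).Nonempty}

section helpers
variable {X : Type*} [MetricSpace X]

def GoodLip (K : Set X) (a b : X) (L : ℝ) (f : ℝ → X) : Prop :=
  (∀ u, f u ∈ K) ∧ (∀ u v, dist (f u) (f v) ≤ |u - v|) ∧ f 0 = a ∧
    ∀ u, dist (f u) b ≤ max (L - u) 0

lemma goodLip_of {K : Set X} {a b : X} {L : ℝ} (hL : 0 ≤ L) (h : ℝ → X)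
    (hK : ∀ u ∈ Icc 0 L, h u ∈ K)
    (hl : ∀ u ∈ Icc 0 L, ∀ v ∈ Icc 0 L, dist (h u) (h v) ≤ |u - v|)
    (h0 : h 0 = a) (h1 : h L = b) :
    GoodLip K a b L (fun u => h (max 0 (min u L))) := by
  have hm : ∀ u : ℝ, max 0 (min u L) ∈ Icc 0 L := fun u =>
    ⟨le_max_left _ _, max_le hL (min_le_right _ _)⟩
  refine ⟨fun u => hK _ (hm u), fun u v => (hl _ (hm u) _ (hm v)).trans ?_, ?_, fun u => ?_⟩
  · have h1 := abs_max_sub_max_le_max 0 (min u L) 0 (min v L)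
    have h2 := abs_min_sub_min_le_max u L v L
    simp only [sub_self, abs_zero] at h1 h2
    have h3 : max |u - v| 0 = |u - v| := max_eq_left (abs_nonneg _)
    have h4 : max 0 |min u L - min v L| = |min u L - min v L| := max_eq_right (abs_nonneg _)
    linarith
  · simp only [min_eq_left hL, max_self, h0]
  · show dist (h (max 0 (min u L))) b ≤ _
    rw [← h1]
    refine (hl _ (hm u) _ ⟨hL, le_rfl⟩).trans ?_
    rw [abs_sub_comm, abs_of_nonneg (by linarith [(hm u).2])]
    rcases le_total u L with h | h
    · rw [min_eq_left h]
      exact le_max_of_le_left (by linarith [le_max_right 0 u])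
    · rw [min_eq_right h, max_eq_right hL]; simp

lemma goodLip_nonneg {K : Set X} {a b : X} {L : ℝ} {f : ℝ → X} (h : GoodLip K a b L f)
    (hL : 0 ≤ L) : f L = b := by
  have := h.2.2.2 L
  simpa using this

lemma exists_min {K : Set X} (hKc : IsCompact K) {a b : X} {L : ℝ} (hL : 0 ≤ L) {f : ℝ → X}
    (hf : GoodLip K a b L f) :
    ∃ L₀ f₀, 0 ≤ L₀ ∧ GoodLip K a b L₀ f₀ ∧ ∀ L', 0 ≤ L' → ∀ f', GoodLip K a b L' f' → L₀ ≤ L' := by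
  let S : Set (ℝ × (ℝ → X)) := (Icc 0 L ×ˢ Set.univ.pi (fun _ => K)) ∩
    {p | (∀ u v, dist (p.2 u) (p.2 v) ≤ |u - v|) ∧ p.2 0 = a ∧
      ∀ u, dist (p.2 u) b ≤ max (p.1 - u) 0}
  have hS : IsCompact S := by
    refine (isCompact_Icc.prod (isCompact_univ_pi fun _ => hKc)).inter_right ?_
    have hc : ∀ u, Continuous (fun p : ℝ × (ℝ → X) => p.2 u) := fun u =>
      (continuous_apply u).comp continuous_snd
    refine IsClosed.inter ?_ (IsClosed.inter ?_ ?_)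
    · show IsClosed {p : ℝ × (ℝ → X) | ∀ u v, dist (p.2 u) (p.2 v) ≤ |u - v|}
      simp only [Set.ofPred_forall]
      exact isClosed_iInter fun u => isClosed_iInter fun v =>
        isClosed_le ((hc u).dist (hc v)) continuous_const
    · exact isClosed_eq (hc 0) continuous_const
    · show IsClosed {p : ℝ × (ℝ → X) | ∀ u, dist (p.2 u) b ≤ max (p.1 - u) 0}
      simp only [Set.ofPred_forall]
      exact isClosed_iInter fun u =>
        isClosed_le ((hc u).dist continuous_const) (by fun_prop)
  have hne : S.Nonempty := ⟨(L, f), ⟨⟨⟨hL, le_rfl⟩, fun u _ => hf.1 u⟩, hf.2⟩⟩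
  obtain ⟨p, hp, hmin⟩ := hS.exists_isMinOn hne continuous_fst.continuousOn
  refine ⟨p.1, p.2, hp.1.1.1, ⟨fun u => hp.1.2 u (mem_univ _), hp.2⟩, fun L' hL' f' hf' => ?_⟩
  by_cases hle : L' ≤ L
  · exact hmin (show (L', f') ∈ S from ⟨⟨⟨hL', hle⟩, fun u _ => hf'.1 u⟩, hf'.2⟩)
  · exact hp.1.1.2.trans (not_le.1 hle).le

lemma MCurve.dist_le_s16 (γ : MCurve X) {u v : ℝ} (hu : u ∈ Icc 0 γ.len) (hv : v ∈ Icc 0 γ.len) :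
    dist (γ.toFun u) (γ.toFun v) ≤ |u - v| := by
  wlog h : u ≤ v generalizing u v
  · rw [dist_comm, abs_sub_comm]; exact this hv hu (le_of_not_ge h)
  have := eVariationOn.edist_le γ.toFun (s := Icc u v) (x := u) (y := v) ⟨le_rfl, h⟩ ⟨h, le_rfl⟩
  rw [γ.arclength u v hu hv h, edist_dist,
    ENNReal.ofReal_le_ofReal_iff (by linarith)] at this
  rw [abs_sub_comm, abs_of_nonneg (by linarith)]; exact this

lemma exists_natural {K : Set X} {a b : X} {L : ℝ} (hL : 0 ≤ L) {f : ℝ → X}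
    (hf : GoodLip K a b L f) :
    ∃ γ : MCurve X, γ.len ≤ L ∧ γ.image ⊆ K ∧ γ.toFun 0 = a ∧ γ.toFun γ.len = b := by
  have hlip : LipschitzWith 1 f := LipschitzWith.of_dist_le_mul fun u v => by
    simpa [Real.dist_eq] using hf.2.1 u v
  set s : Set ℝ := Icc 0 L with hs
  have hbv : LocallyBoundedVariationOn f s := hlip.locallyBoundedVariationOn s
  have m0 : (0 : ℝ) ∈ s := ⟨le_rfl, hL⟩
  have mL : L ∈ s := ⟨hL, le_rfl⟩
  have hle : ∀ x ∈ s, ∀ y ∈ s, x ≤ y → variationOnFromTo f s x y ≤ y - x := by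
    intro x hx y hy hxy
    rw [variationOnFromTo.eq_of_le f s hxy]
    have h1 : eVariationOn f (s ∩ Icc x y) ≤ ENNReal.ofReal (y - x) := by
      have := (hlip.lipschitzOnWith (s := univ)).comp_eVariationOn_le (g := (id : ℝ → ℝ))
        (s := s ∩ Icc x y) (mapsTo_univ _ _)
      rw [(monotoneOn_id).eVariationOn_eq hx hy] at this
      simpa using this
    exact ENNReal.toReal_le_of_le_ofReal (by linarith) h1
  set φ := variationOnFromTo f s 0 with hφ
  have hmono : MonotoneOn φ s := variationOnFromTo.monotoneOn hbv m0
  have φ0 : φ 0 = 0 := variationOnFromTo.self f s 0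
  have hφc : ContinuousOn φ s := by
    have : LipschitzOnWith 1 φ s := LipschitzOnWith.of_dist_le_mul fun x hx y hy => by
      wlog h : y ≤ x generalizing x y
      · rw [dist_comm, dist_comm x]; exact this y hy x hx (le_of_not_ge h)
      rw [Real.dist_eq, Real.dist_eq, hφ, variationOnFromTo.sub_right hbv m0 hx hy,
        abs_of_nonneg (variationOnFromTo.nonneg_of_le f s h), abs_of_nonneg (by linarith)]
      simpa using hle y hy x hx h
    exact this.continuousOn
  have himg : φ '' s = Icc 0 (φ L) := by
    apply Subset.antisymm
    · rintro _ ⟨x, hx, rfl⟩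
      exact ⟨φ0 ▸ hmono m0 hx hx.1, hmono hx mL hx.2⟩
    · have := intermediate_value_Icc hL hφc
      rwa [φ0] at this
  have hus := has_unit_speed_naturalParameterization f hbv m0
  rw [← hφ, himg] at hus
  have hval : ∀ x ∈ s, naturalParameterization f s 0 (φ x) = f x := fun x hx =>
    edist_eq_zero.1 (edist_naturalParameterization_eq_zero hbv m0 hx)
  refine ⟨⟨φ L, variationOnFromTo.nonneg_of_le f s hL, naturalParameterization f s 0, ?_⟩,
    ?_, ?_, ?_, ?_⟩
  · intro u v hu hv huv
    have := hus hu hv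
    rw [inter_eq_right.2 (Icc_subset_Icc hu.1 hv.2)] at this
    simpa using this
  · simpa using hle 0 m0 L mL hL
  · rintro _ ⟨u, hu, rfl⟩
    exact hf.1 _
  · show naturalParameterization f s 0 0 = a
    have := hval 0 m0
    rw [φ0] at this
    rw [this, hf.2.2.1]
  · exact (hval L mL).trans (goodLip_nonneg hf hL)

lemma exists_simple {K : Set X} (hKc : IsCompact K) {a b : X} {L : ℝ} (hL : 0 ≤ L) {f : ℝ → X}
    (hf : GoodLip K a b L f) :
    ∃ γ : MCurve X, γ.IsSimple ∧ γ.image ⊆ K ∧ γ.toFun 0 = a ∧ γ.toFun γ.len = b := by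
  obtain ⟨L₀, f₀, hL₀, hf₀, hmin⟩ := exists_min hKc hL hf
  obtain ⟨γ, hl, hK, h0, h1⟩ := exists_natural hL₀ hf₀
  refine ⟨γ, ?_, hK, h0, h1⟩
  have main : ∀ s ∈ Icc 0 γ.len, ∀ t ∈ Icc 0 γ.len, γ.toFun s = γ.toFun t → ¬ s < t := by
    intro s hs t ht hst hlt
    have hnn : 0 ≤ γ.len - (t - s) := by linarith [hs.1, ht.2]
    have := hmin _ hnn _ (goodLip_of (K := K) (a := a) (b := b) hnn
      (fun u => if u ≤ s then γ.toFun u else γ.toFun (u + (t - s))) ?_ ?_ ?_ ?_)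
    · linarith
    · intro u hu
      show (if u ≤ s then γ.toFun u else γ.toFun (u + (t - s))) ∈ K
      split_ifs with h
      · exact hK ⟨u, ⟨hu.1, h.trans hs.2⟩, rfl⟩
      · exact hK ⟨_, ⟨by linarith [hu.1], by linarith [hu.2]⟩, rfl⟩
    · have aux : ∀ u ∈ Icc 0 (γ.len - (t - s)), ∀ v ∈ Icc 0 (γ.len - (t - s)), u ≤ s → ¬ v ≤ s →
          dist (γ.toFun u) (γ.toFun (v + (t - s))) ≤ |u - v| := by
        intro u hu v hv hus hvs
        have e1 := γ.dist_le_s16 (u := u) (v := s) ⟨hu.1, hus.trans hs.2⟩ hs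
        have e2 := γ.dist_le_s16 (u := t) (v := v + (t - s)) ht
          ⟨by linarith [hv.1], by linarith [hv.2]⟩
        have e3 := dist_triangle (γ.toFun u) (γ.toFun s) (γ.toFun (v + (t - s)))
        rw [abs_of_nonpos (by linarith)] at e1
        rw [abs_of_nonpos (by linarith)] at e2
        rw [← hst] at e2
        rw [abs_of_nonpos (by linarith)]
        linarith
      intro u hu v hv
      show dist (if u ≤ s then γ.toFun u else γ.toFun (u + (t - s)))
        (if v ≤ s then γ.toFun v else γ.toFun (v + (t - s))) ≤ |u - v|
      split_ifs with h h' h'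
      · exact γ.dist_le_s16 ⟨hu.1, h.trans hs.2⟩ ⟨hv.1, h'.trans hs.2⟩
      · exact aux u hu v hv h h'
      · rw [dist_comm, abs_sub_comm]; exact aux v hv u hu h' h
      · have := γ.dist_le_s16 (u := u + (t - s)) (v := v + (t - s))
          ⟨by linarith [hu.1], by linarith [hu.2]⟩ ⟨by linarith [hv.1], by linarith [hv.2]⟩
        simpa using this
    · simp [hs.1, h0]
    · show (if γ.len - (t - s) ≤ s then γ.toFun _ else γ.toFun _) = b
      split_ifs with h
      · have e : t = γ.len := le_antisymm ht.2 (by linarith)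
        have e2 : γ.len - (t - s) = s := by linarith
        rw [e2, hst, e, h1]
      · rw [sub_add_cancel, h1]
  intro s hs t ht hst
  exact le_antisymm (not_lt.1 (main t ht s hs hst.symm)) (not_lt.1 (main s hs t ht hst))

lemma MCurve.exists_sub (γ : MCurve X) {u v : ℝ} (hu : u ∈ Icc 0 γ.len) (hv : v ∈ Icc 0 γ.len)
    (huv : u ≤ v) : ∃ σ : MCurve X, σ.IsSimple ∧ σ.image ⊆ γ.image ∧ σ.toFun 0 = γ.toFun u ∧
      σ.toFun σ.len = γ.toFun v := by
  have hc : ContinuousOn γ.toFun (Icc 0 γ.len) := by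
    have : LipschitzOnWith 1 γ.toFun (Icc 0 γ.len) := LipschitzOnWith.of_dist_le_mul
      fun x hx y hy => by simpa [Real.dist_eq] using γ.dist_le_s16 hx hy
    exact this.continuousOn
  have hK : IsCompact γ.image := isCompact_Icc.image_of_continuousOn hc
  have hm : ∀ x ∈ Icc 0 (v - u), u + x ∈ Icc 0 γ.len := fun x hx =>
    ⟨by linarith [hx.1, hu.1], by linarith [hx.2, hv.2]⟩
  exact exists_simple hK (sub_nonneg.2 huv) (goodLip_of (sub_nonneg.2 huv)
    (fun x => γ.toFun (u + x)) (fun x hx => ⟨_, hm x hx, rfl⟩)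
    (fun x hx y hy => by simpa using γ.dist_le_s16 (hm x hx) (hm y hy)) (by simp) (by simp))

lemma innerBall_subset (x : X) (δ : ℝ) : innerBall x δ ⊆ Metric.ball x δ := by
  intro y hy
  have h : edist x y ≤ innerDist x y := by
    refine le_iInf fun γ => le_iInf fun h0 => le_iInf fun h1 => ?_
    have := eVariationOn.edist_le γ.toFun (s := Icc 0 γ.len) (x := 0) (y := γ.len)
      ⟨le_rfl, γ.len_nonneg⟩ ⟨γ.len_nonneg, le_rfl⟩
    rw [γ.arclength 0 γ.len ⟨le_rfl, γ.len_nonneg⟩ ⟨γ.len_nonneg, le_rfl⟩ γ.len_nonneg,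
      h0, h1, sub_zero] at this
    exact this
  have h2 := h.trans_lt hy
  rw [edist_dist] at h2
  rw [Metric.mem_ball, dist_comm]
  exact (ENNReal.ofReal_lt_ofReal_iff_of_nonneg dist_nonneg).1 h2

lemma exists_cross {F : Set X} {x : X} (hx : x ∈ curveBoundary F) {U : Set X} (hU : IsOpen U)
    (hxU : x ∈ U) : ∃ σ : MCurve X, σ.IsSimple ∧ σ.image ⊆ U ∧
      ENNReal.ofReal |Set.indicator F (fun _ => (1 : ℝ)) (σ.toFun σ.len) -
        Set.indicator F (fun _ => (1 : ℝ)) (σ.toFun 0)| = 1 := by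
  obtain ⟨δ, hδ, hb⟩ := Metric.isOpen_iff.1 hU x hxU
  obtain ⟨γ, hγ, ⟨_, ⟨u, hu, rfl⟩, huF⟩, ⟨_, ⟨v, hv, rfl⟩, hvF⟩⟩ := hx δ hδ
  have hγU : γ.image ⊆ U := hγ.trans ((innerBall_subset x δ).trans hb)
  have hvF' : γ.toFun v ∉ F := hvF
  rcases le_total u v with h | h
  · obtain ⟨σ, h1, h2, h3, h4⟩ := γ.exists_sub hu hv h
    exact ⟨σ, h1, h2.trans hγU, by rw [h3, h4]; simp [huF, hvF']⟩
  · obtain ⟨σ, h1, h2, h3, h4⟩ := γ.exists_sub hv hu h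
    exact ⟨σ, h1, h2.trans hγU, by rw [h3, h4]; simp [huF, hvF']⟩

lemma card_le_pVar (F : Set X) (T : Finset X) (hT : (↑T : Set X) ⊆ curveBoundary F) :
    ((T.card : ℕ) : ℝ≥0∞) ≤ pVar (Set.indicator F (fun _ => (1 : ℝ))) := by
  obtain ⟨U, hU, hd⟩ := T.finite_toSet.t2_separation
  let e := T.equivFin.symm
  have hex := fun i : Fin T.card => exists_cross (hT (e i).2) (hU (e i).1).2 (hU (e i).1).1
  choose σ h1 h2 h3 using hex
  have hdis : ∀ i j, i ≠ j → Disjoint (σ i).image (σ j).image := fun i j hij =>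
    (hd (e i).2 (e j).2 (fun h => hij (e.injective (Subtype.ext h)))).mono (h2 i) (h2 j)
  calc ((T.card : ℕ) : ℝ≥0∞) = ∑ i : Fin T.card, ENNReal.ofReal
        |Set.indicator F (fun _ => (1 : ℝ)) ((σ i).toFun (σ i).len) -
        Set.indicator F (fun _ => (1 : ℝ)) ((σ i).toFun 0)| := by simp only [h3]; simp
    _ ≤ _ := by
        unfold pVar
        refine le_iSup_of_le T.card ?_
        refine le_iSup_of_le σ ?_
        refine le_iSup_of_le h1 ?_
        exact le_iSup_of_le hdis le_rfl

end helpers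

theorem stmt16 {X : Type*} [MetricSpace X] [CompleteSpace X] [ConnectedSpace X]
    [MeasurableSpace X] [BorelSpace X]
    (h0 : 0 < μH[1] (Set.univ : Set X)) (h1 : μH[1] (Set.univ : Set X) < ⊤)
    (F : Set X) (hF : pVar (Set.indicator F (fun _ => (1 : ℝ))) < ⊤) :
    (curveBoundary F).Finite ∧
      ((curveBoundary F).ncard : ℝ≥0∞) ≤ pVar (Set.indicator F (fun _ => (1 : ℝ))) := by
  have key : ∀ T : Finset X, (↑T : Set X) ⊆ curveBoundary F →
      ((T.card : ℕ) : ℝ≥0∞) ≤ pVar (Set.indicator F (fun _ => (1 : ℝ))) :=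
    fun T hT => card_le_pVar F T hT
  have hfin : (curveBoundary F).Finite := by
    by_contra hinf
    obtain ⟨n, hn⟩ := ENNReal.exists_nat_gt hF.ne
    obtain ⟨T, hT, hc⟩ := Set.Infinite.exists_subset_card_eq hinf n
    have := key T hT
    rw [hc] at this
    exact absurd hn (not_lt.2 this)
  refine ⟨hfin, ?_⟩
  rw [Set.ncard_eq_toFinset_card _ hfin]
  exact key _ (by simp)
end
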